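/- The star combinatory calculus for arithmetic has the strong normalization property: there is no infinite chain of one-step reductions starting from any term. -/

import Mathlib

namespace StarArith

/-- Finite types over the ground type `N`, closed under `→` and `*`. -/
inductive Ty : Type where
  | ground : Ty          -- the type `N` of natural numbers
  | arrow : Ty → Ty → Ty
  | star : Ty → Ty
deriving DecidableEq, Repr

/-- Terms of the star combinatory calculus for arithmetic. -/
inductive ATerm : Ty → Type where
  | var (n : ℕ) (σ : Ty) : ATerm σ
  | zero : ATerm .ground
  | succ : ATerm (Ty.ground.arrow .ground)
  | recr (σ : Ty) :
      ATerm (Ty.ground.arrow (σ.arrow ((σ.arrow (Ty.ground.arrow σ)).arrow σ)))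
  | pi (σ τ : Ty) : ATerm (σ.arrow (τ.arrow σ))
  | sigma (ρ σ τ : Ty) :
      ATerm ((ρ.arrow (σ.arrow τ)).arrow ((ρ.arrow σ).arrow (ρ.arrow τ)))
  | sing (σ : Ty) : ATerm (σ.arrow σ.star)
  | union (σ : Ty) : ATerm (σ.star.arrow (σ.star.arrow σ.star))
  | bigUnion (σ τ : Ty) : ATerm (σ.star.arrow ((σ.arrow τ.star).arrow τ.star))
  | app {σ τ : Ty} (t : ATerm (σ.arrow τ)) (q : ATerm σ) : ATerm τ

/-- One-step reduction: apply one of the conversions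
`Σtqr ⇝ tr(qr)`, `Πtq ⇝ t`, `⋃(𝔰t)q ⇝ qt`, `⋃(∪tq)r ⇝ ∪(⋃tr)(⋃qr)`,
`R0qr ⇝ q`, `R(St)qr ⇝ r(Rtqr)t` to a subterm. -/
inductive Step : {σ : Ty} → ATerm σ → ATerm σ → Prop where
  | sigma {ρ σ τ : Ty} (t : ATerm (ρ.arrow (σ.arrow τ))) (q : ATerm (ρ.arrow σ))
      (r : ATerm ρ) :
      Step ((((ATerm.sigma ρ σ τ).app t).app q).app r) ((t.app r).app (q.app r))
  | pi {σ τ : Ty} (t : ATerm σ) (q : ATerm τ) :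
      Step (((ATerm.pi σ τ).app t).app q) t
  | bigUnion_sing {σ τ : Ty} (t : ATerm σ) (q : ATerm (σ.arrow τ.star)) :
      Step (((ATerm.bigUnion σ τ).app ((ATerm.sing σ).app t)).app q) (q.app t)
  | bigUnion_union {σ τ : Ty} (t q : ATerm σ.star) (r : ATerm (σ.arrow τ.star)) :
      Step (((ATerm.bigUnion σ τ).app (((ATerm.union σ).app t).app q)).app r)
        (((ATerm.union τ).app (((ATerm.bigUnion σ τ).app t).app r)).app
          (((ATerm.bigUnion σ τ).app q).app r))
  | rec_zero {σ : Ty} (q : ATerm σ) (r : ATerm (σ.arrow (Ty.ground.arrow σ))) :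
      Step ((((ATerm.recr σ).app .zero).app q).app r) q
  | rec_succ {σ : Ty} (t : ATerm .ground) (q : ATerm σ)
      (r : ATerm (σ.arrow (Ty.ground.arrow σ))) :
      Step ((((ATerm.recr σ).app (ATerm.succ.app t)).app q).app r)
        ((r.app ((((ATerm.recr σ).app t).app q).app r)).app t)
  | app_left {σ τ : Ty} {t t' : ATerm (σ.arrow τ)} (q : ATerm σ) :
      Step t t' → Step (t.app q) (t'.app q)
  | app_right {σ τ : Ty} (t : ATerm (σ.arrow τ)) {q q' : ATerm σ} :
      Step q q' → Step (t.app q) (t.app q')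

/-- `t ⪰ q` : `t` reduces to `q` by finitely many (possibly zero) one-step reductions. -/
def Reduces {σ : Ty} (t q : ATerm σ) : Prop :=
  Relation.ReflTransGen Step t q

/-- A term is normal if no one-step reduction applies to it. -/
def Normal {σ : Ty} (t : ATerm σ) : Prop :=
  ∀ q : ATerm σ, ¬ Step t q

/-- A term is strongly normalizable if there is no infinite chain of one-step
reductions starting from it. -/
def SN {σ : Ty} (t : ATerm σ) : Prop :=
  ¬ ∃ f : ℕ → ATerm σ, f 0 = t ∧ ∀ n : ℕ, Step (f n) (f (n + 1))

/-- A term is closed if it contains no variables. -/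
def ATerm.ClosedT : {σ : Ty} → ATerm σ → Prop
  | _, .var _ _ => False
  | _, .app t q => t.ClosedT ∧ q.ClosedT
  | _, _ => True

/-- A term of star type is set-like if it is constructed solely from terms of the
form `𝔰q` and the constant `∪`. -/
inductive SetLike : {σ : Ty} → ATerm σ.star → Prop where
  | sing {σ : Ty} (q : ATerm σ) : SetLike ((ATerm.sing σ).app q)
  | union {σ : Ty} {t₁ t₂ : ATerm σ.star} :
      SetLike t₁ → SetLike t₂ → SetLike (((ATerm.union σ).app t₁).app t₂)

/-- `SMem s t` : `s` is a surface element of the star-type term `t`, i.e. `s ∈ SM(t)`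
where `SM(𝔰q) = {q}`, `SM(∪qr) = SM(q) ∪ SM(r)` and `SM(t) = ∅` otherwise. -/
inductive SMem : {σ : Ty} → ATerm σ → ATerm σ.star → Prop where
  | sing {σ : Ty} (q : ATerm σ) : SMem q ((ATerm.sing σ).app q)
  | unionL {σ : Ty} {s : ATerm σ} {a b : ATerm σ.star} :
      SMem s a → SMem s (((ATerm.union σ).app a).app b)
  | unionR {σ : Ty} {s : ATerm σ} {a b : ATerm σ.star} :
      SMem s b → SMem s (((ATerm.union σ).app a).app b)

/-- Tait-style reducibility, defined by recursion on the type: at ground type `N`,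
reducible = strongly normalizable; at `σ → τ`, `t` is reducible iff `tq` is
reducible for every reducible `q`; at `σ*`, `t` is reducible iff `t` is strongly
normalizable and all surface elements of all terms obtained by reduction of `t` are
reducible. -/
def Red : {σ : Ty} → ATerm σ → Prop
  | .ground, t => SN t
  | .arrow σ _, t => ∀ q : ATerm σ, Red q → Red (t.app q)
  | .star σ, t => SN t ∧ ∀ q : ATerm σ.star, Reduces t q → ∀ s : ATerm σ, SMem s q → Red s

/-- The numeral `S(S(⋯(S0)))` for the natural number `n`. -/
def numeral : ℕ → ATerm .ground
  | 0 => .zero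
  | n + 1 => ATerm.succ.app (numeral n)

end StarArith

namespace StarArith

/-- Accessibility formulation of strong normalization. -/
def StepAcc {σ : Ty} (t : ATerm σ) : Prop :=
  Acc (fun a b : ATerm σ => Step b a) t

theorem StepAcc.sn {σ : Ty} {t : ATerm σ} (h : StepAcc t) : SN t := by
  induction h with
  | intro t _ ih =>
    rintro ⟨f, rfl, hf⟩
    exact ih (f 1) (hf 0) ⟨fun n => f (n + 1), rfl, fun n => hf (n + 1)⟩

theorem StepAcc.of_app {σ τ : Ty} {t : ATerm (σ.arrow τ)} {q : ATerm σ}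
    (h : StepAcc (t.app q)) : StepAcc t := by
  generalize hu : t.app q = u at h
  induction h generalizing t with
  | intro u _ ih =>
    subst hu
    exact ⟨_, fun t' ht => ih _ (Step.app_left q ht) rfl⟩

/-- The number of arguments still missing before the term becomes neutral. It vanishes on
variables and on full redexes; values such as `0`, `St`, `𝔰t` and `∪tq` lack one argument. -/
def ATerm.lack : {σ : Ty} → ATerm σ → ℕ
  | _, .var _ _ => 0
  | _, .zero => 1
  | _, .succ => 2
  | _, .recr _ => 3
  | _, .pi _ _ => 2
  | _, .sigma _ _ _ => 3
  | _, .sing _ => 2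
  | _, .union _ => 3
  | _, .bigUnion _ _ => 2
  | _, .app t _ => t.lack - 1

/-- If the function part does not lack exactly one argument, the application is not a redex. -/
theorem Step.app_inv {σ τ : Ty} {t : ATerm (σ.arrow τ)} {q : ATerm σ} {u : ATerm τ}
    (h : Step (t.app q) u) (ht : t.lack ≠ 1) :
    (∃ t', Step t t' ∧ u = t'.app q) ∨ ∃ q', Step q q' ∧ u = t.app q' := by
  cases h with
  | app_left _ h => exact .inl ⟨_, h, rfl⟩
  | app_right _ h => exact .inr ⟨_, h, rfl⟩
  | _ => simp [ATerm.lack] at ht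

/-- Reducibility at the ground type: accessibility under reduction and removal of `S`. -/
inductive GroundRed : ATerm .ground → Prop where
  | intro (t : ATerm .ground) (step : ∀ t', Step t t' → GroundRed t')
      (pred : ∀ s, t = ATerm.succ.app s → GroundRed s) : GroundRed t

/-- Reducibility at a star type, relative to a predicate on the possible elements:
accessibility under reduction and decomposition of unions, with all elements satisfying `P`. -/
inductive StarRed {σ : Ty} (P : ATerm σ → Prop) : ATerm σ.star → Prop where
  | intro (t : ATerm σ.star) (step : ∀ t', Step t t' → StarRed P t')
      (elem : ∀ s, t = (ATerm.sing σ).app s → P s)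
      (left : ∀ a b, t = ((ATerm.union σ).app a).app b → StarRed P a)
      (right : ∀ a b, t = ((ATerm.union σ).app a).app b → StarRed P b) : StarRed P t

/-- The reducibility candidate of each type. -/
def Cand : (σ : Ty) → ATerm σ → Prop
  | .ground => GroundRed
  | .arrow σ τ => fun t => ∀ q, Cand σ q → Cand τ (t.app q)
  | .star σ => StarRed (Cand σ)

theorem GroundRed.stepAcc {t : ATerm .ground} (h : GroundRed t) : StepAcc t := by
  induction h with
  | intro t _ _ ih _ => exact ⟨_, fun t' h => ih t' h⟩

theorem StarRed.stepAcc {σ : Ty} {P : ATerm σ → Prop} {t : ATerm σ.star}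
    (h : StarRed P t) : StepAcc t := by
  induction h with
  | intro t _ _ _ _ ih _ _ => exact ⟨_, fun t' h => ih t' h⟩

theorem GroundRed.step {t t' : ATerm .ground} (h : GroundRed t) (hs : Step t t') :
    GroundRed t' := by
  cases h with
  | intro _ h _ => exact h _ hs

theorem StarRed.step {σ : Ty} {P : ATerm σ → Prop} {t t' : ATerm σ.star}
    (h : StarRed P t) (hs : Step t t') : StarRed P t' := by
  cases h with
  | intro _ h _ _ _ => exact h _ hs

theorem Cand.step {σ : Ty} {t t' : ATerm σ} (h : Cand σ t) (hs : Step t t') : Cand σ t' := by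
  induction σ with
  | ground => exact GroundRed.step h hs
  | arrow σ τ _ ih => exact fun q hq => ih (h q hq) (Step.app_left q hs)
  | star σ _ => exact StarRed.step h hs

/-- Candidates contain only accessible terms, and contain every neutral term
all of whose one-step reducts they contain. -/
theorem Cand.stepAcc_and_neutral (σ : Ty) :
    (∀ t, Cand σ t → StepAcc t) ∧
      ∀ t : ATerm σ, t.lack = 0 → (∀ t', Step t t' → Cand σ t') → Cand σ t := by
  induction σ with
  | ground =>
    refine ⟨fun t h => GroundRed.stepAcc h, fun t ht h => ⟨t, h, ?_⟩⟩
    rintro s rfl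
    simp [ATerm.lack] at ht
  | star σ _ =>
    refine ⟨fun t h => StarRed.stepAcc h, fun t ht h => ⟨t, h, ?_, ?_, ?_⟩⟩
    · rintro s rfl
      simp [ATerm.lack] at ht
    · rintro a b rfl
      simp [ATerm.lack] at ht
    · rintro a b rfl
      simp [ATerm.lack] at ht
  | arrow σ τ ihσ ihτ =>
    constructor
    · intro t h
      have hv : Cand σ (.var 0 σ) := ihσ.2 _ rfl fun t' h => nomatch h
      exact (ihτ.1 _ (h _ hv)).of_app
    · intro t ht h q hq
      have hacc := ihσ.1 q hq
      induction hacc with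
      | intro q _ ih =>
        refine ihτ.2 _ (by simp [ATerm.lack, ht]) fun u hu => ?_
        rcases hu.app_inv (by simp [ht]) with ⟨t', hs, rfl⟩ | ⟨q', hs, rfl⟩
        · exact h t' hs q hq
        · exact ih q' hs (hq.step hs)

theorem Cand.stepAcc {σ : Ty} {t : ATerm σ} (h : Cand σ t) : StepAcc t :=
  (Cand.stepAcc_and_neutral σ).1 t h

theorem Cand.of_neutral {σ : Ty} {t : ATerm σ} (ht : t.lack = 0)
    (h : ∀ t', Step t t' → Cand σ t') : Cand σ t :=
  (Cand.stepAcc_and_neutral σ).2 t ht h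

theorem Cand.var (n : ℕ) (σ : Ty) : Cand σ (.var n σ) :=
  .of_neutral rfl fun _ h => nomatch h

theorem Cand.zero : Cand .ground .zero :=
  GroundRed.intro _ (fun _ h => nomatch h) (fun _ h => nomatch h)

theorem Cand.succ : Cand _ .succ := by
  intro t ht
  change GroundRed t at ht
  change GroundRed _
  induction ht with
  | intro t hs hp ih _ =>
    refine ⟨_, fun u hu => ?_, fun s h => ?_⟩
    · rcases hu.app_inv (by simp [ATerm.lack]) with ⟨_, h, rfl⟩ | ⟨t', h, rfl⟩
      · nomatch h
      · exact ih t' h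
    · cases h
      exact ⟨_, hs, hp⟩

theorem Cand.sing (σ : Ty) : Cand _ (.sing σ) := by
  intro t ht
  have hacc := ht.stepAcc
  change StarRed _ _
  induction hacc with
  | intro t _ ih =>
    refine ⟨_, fun u hu => ?_, fun s h => ?_, fun a b h => ?_, fun a b h => ?_⟩
    · rcases hu.app_inv (by simp [ATerm.lack]) with ⟨_, h, rfl⟩ | ⟨t', h, rfl⟩
      · nomatch h
      · exact ih t' h (ht.step h)
    · cases h
      exact ht
    · nomatch h
    · nomatch h

theorem Cand.union (σ : Ty) : Cand _ (.union σ) := by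
  intro a ha b hb
  have hacc := ha.stepAcc
  induction hacc generalizing b with
  | intro a _ iha =>
    have hacc := hb.stepAcc
    induction hacc with
    | intro b _ ihb =>
      change StarRed _ _
      refine ⟨_, fun u hu => ?_, fun s h => ?_, fun _ _ h => ?_, fun _ _ h => ?_⟩
      · rcases hu.app_inv (by simp [ATerm.lack]) with ⟨_, h, rfl⟩ | ⟨b', h, rfl⟩
        · rcases h.app_inv (by simp [ATerm.lack]) with ⟨_, h₁, rfl⟩ | ⟨a', h₁, rfl⟩
          · nomatch h₁
          · exact iha a' h₁ (ha.step h₁) b hb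
        · exact ihb b' h (hb.step h)
      · nomatch h
      · cases h
        exact ha
      · cases h
        exact hb

theorem Cand.pi (σ τ : Ty) : Cand _ (.pi σ τ) := by
  intro t ht q hq
  have hacc := ht.stepAcc
  induction hacc generalizing q with
  | intro t _ iht =>
    have hacc := hq.stepAcc
    induction hacc with
    | intro q _ ihq =>
      refine Cand.of_neutral rfl fun u hu => ?_
      cases hu with
      | pi => exact ht
      | app_left _ h =>
        rcases h.app_inv (by simp [ATerm.lack]) with ⟨_, h₁, rfl⟩ | ⟨t', h₁, rfl⟩
        · nomatch h₁
        · exact iht t' h₁ (ht.step h₁) q hq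
      | app_right _ h => exact ihq _ h (hq.step h)

theorem Cand.sigma (ρ σ τ : Ty) : Cand _ (.sigma ρ σ τ) := by
  intro t ht q hq r hr
  have hacc := ht.stepAcc
  induction hacc generalizing q r with
  | intro t _ iht =>
    have hacc := hq.stepAcc
    induction hacc generalizing r with
    | intro q _ ihq =>
      have hacc := hr.stepAcc
      induction hacc with
      | intro r _ ihr =>
        refine Cand.of_neutral rfl fun u hu => ?_
        cases hu with
        | sigma => exact ht r hr _ (hq r hr)
        | app_left _ h =>
          rcases h.app_inv (by simp [ATerm.lack]) with ⟨_, h₁, rfl⟩ | ⟨q', h₁, rfl⟩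
          · rcases h₁.app_inv (by simp [ATerm.lack]) with ⟨_, h₂, rfl⟩ | ⟨t', h₂, rfl⟩
            · nomatch h₂
            · exact iht t' h₂ (ht.step h₂) q hq r hr
          · exact ihq q' h₁ (hq.step h₁) r hr
        | app_right _ h => exact ihr _ h (hr.step h)

theorem Cand.bigUnion (σ τ : Ty) : Cand _ (.bigUnion σ τ) := by
  intro t ht r hr
  change StarRed _ t at ht
  induction ht generalizing r with
  | intro t _ elem _ _ iht ihl ihr =>
    have hacc := hr.stepAcc
    induction hacc with
    | intro r _ ih =>
      refine Cand.of_neutral rfl fun u hu => ?_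
      cases hu with
      | bigUnion_sing s => exact hr s (elem s rfl)
      | bigUnion_union a b =>
        exact Cand.union τ _ (ihl a b rfl r hr) _ (ihr a b rfl r hr)
      | app_left _ h =>
        rcases h.app_inv (by simp [ATerm.lack]) with ⟨_, h₁, rfl⟩ | ⟨t', h₁, rfl⟩
        · nomatch h₁
        · exact iht t' h₁ r hr
      | app_right _ h => exact ih _ h (hr.step h)

theorem Cand.recr (σ : Ty) : Cand _ (.recr σ) := by
  intro t ht q hq r hr
  change GroundRed t at ht
  induction ht generalizing q r with
  | intro t _ pred iht ihp =>
    have hacc := hq.stepAcc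
    induction hacc generalizing r with
    | intro q _ ihq =>
      have hacc := hr.stepAcc
      induction hacc with
      | intro r _ ihr =>
        refine Cand.of_neutral rfl fun u hu => ?_
        cases hu with
        | rec_zero => exact hq
        | rec_succ s => exact hr _ (ihp s rfl q hq r hr) s (pred s rfl)
        | app_left _ h =>
          rcases h.app_inv (by simp [ATerm.lack]) with ⟨_, h₁, rfl⟩ | ⟨q', h₁, rfl⟩
          · rcases h₁.app_inv (by simp [ATerm.lack]) with ⟨_, h₂, rfl⟩ | ⟨t', h₂, rfl⟩
            · nomatch h₂
            · exact iht t' h₂ q hq r hr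
          · exact ihq q' h₁ (hq.step h₁) r hr
        | app_right _ h => exact ihr _ h (hr.step h)

theorem ATerm.cand {σ : Ty} (t : ATerm σ) : Cand σ t := by
  induction t with
  | var n σ => exact .var n σ
  | zero => exact .zero
  | succ => exact .succ
  | recr σ => exact .recr σ
  | pi σ τ => exact .pi σ τ
  | sigma ρ σ τ => exact .sigma ρ σ τ
  | sing σ => exact .sing σ
  | union σ => exact .union σ
  | bigUnion σ τ => exact .bigUnion σ τ
  | app t q iht ihq => exact iht q ihq

end StarArith

open StarArith in
/-- The star combinatory calculus for arithmetic has the strong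
normalization property: there is no infinite chain of one-step reductions starting
from any term. -/
theorem arith_star_calculus_strong_normalization {σ : Ty} (t : ATerm σ) : SN t := by
  exact t.cand.stepAcc.sn
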